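/- arXiv:2211.05954 — 3 statements merged into one kernel-verified Lean document; each statement's English description precedes it below -/
import Mathlib

section
/- Consider the unit-noise Gaussian sequence model on ℝᵐ with m ≥ 2, and the symmetric spike prior π_S^{μ,m}. The Bayes risk of π_S^{μ,m} equals B(π_S^{μ,m}) = E_{μe₁}(θ̂₁ − μ)² + (m−1)·E_{μe₂}(θ̂₁²), where E_{μe₁} is expectation with y ~ N(μe₁, I_m), E_{μe₂} with y ~ N(μe₂, I_m), and θ̂₁ = μ(e^{μy₁} − e^{−μy₁}) / Σ_{i=1}^m (e^{μyᵢ} + e^{−μyᵢ}) is the posterior-mean estimator of the first coordinate under prior π_S^{μ,m}. -/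
open MeasureTheory ProbabilityTheory Filter
open scoped ENNReal NNReal Topology

noncomputable section

/-- Unit-noise Gaussian sequence model on `ℝᵐ`: the law of `y` under parameter `θ`
(product of `N(θ i, σ²)`; we use it with `σ = 1`). -/
def gsm (m : ℕ) (θ : Fin m → ℝ) (σ : ℝ) : Measure (Fin m → ℝ) :=
  MeasureTheory.Measure.pi fun i => gaussianReal (θ i) ((σ ^ 2).toNNReal)

/-- Squared-error risk `E_θ ‖est(y) − θ‖₂²` of an estimator at parameter `θ`. -/
def risk (m : ℕ) (σ : ℝ) (est : (Fin m → ℝ) → Fin m → ℝ) (θ : Fin m → ℝ) : ℝ≥0∞ :=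
  ∫⁻ y, ENNReal.ofReal (∑ i, (est y i - θ i) ^ 2) ∂(gsm m θ σ)

/-- Bayes risk of a prior `π` on `ℝᵐ` in the unit-noise Gaussian sequence model:
the infimum over measurable estimators of the integrated risk. -/
def bayesRisk (m : ℕ) (π : Measure (Fin m → ℝ)) : ℝ≥0∞ :=
  ⨅ (est : (Fin m → ℝ) → Fin m → ℝ) (_ : Measurable est),
    ∫⁻ θ, risk m 1 est θ ∂π

/-- Symmetric spike prior `π_S^{μ,m}`: mass `1/(2m)` at each of the `2m` points `±μ eᵢ`. -/
def spikePrior (m : ℕ) (μ : ℝ) : Measure (Fin m → ℝ) :=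
  (2 * (m : ℝ≥0∞))⁻¹ • ∑ i : Fin m,
    (Measure.dirac (fun j => if j = i then μ else 0) +
      Measure.dirac (fun j => if j = i then -μ else 0))

/-- Posterior-mean estimate of the first coordinate under the symmetric spike prior:
`θ̂₁(y) = μ (e^{μ y₁} − e^{−μ y₁}) / ∑ᵢ (e^{μ yᵢ} + e^{−μ yᵢ})` (dimension `m + 2 ≥ 2`). -/
def postMean1 (m : ℕ) (μ : ℝ) (y : Fin (m + 2) → ℝ) : ℝ :=
  μ * (Real.exp (μ * y 0) - Real.exp (-(μ * y 0))) /
    ∑ i, (Real.exp (μ * y i) + Real.exp (-(μ * y i)))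

lemma pi_withDensity_aux {N : ℕ} (μ : Fin N → Measure ℝ) [∀ i, IsProbabilityMeasure (μ i)]
    (f : Fin N → ℝ → ℝ≥0∞) (hf : ∀ i, Measurable (f i))
    [∀ i, SigmaFinite ((μ i).withDensity (f i))] :
    Measure.pi (fun i => (μ i).withDensity (f i)) =
      (Measure.pi μ).withDensity (fun y => ∏ i, f i (y i)) := by
  refine Measure.pi_eq fun s hs => ?_
  rw [withDensity_apply _ (MeasurableSet.univ_pi hs),
    ← lintegral_indicator (MeasurableSet.univ_pi hs)]
  have h1 : (fun y : Fin N → ℝ => (Set.univ.pi s).indicator (fun y => ∏ i, f i (y i)) y)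
      = fun y => ∏ i, (s i).indicator (f i) (y i) := by
    funext y
    by_cases hy : y ∈ Set.univ.pi s
    · rw [Set.indicator_of_mem hy]
      refine Finset.prod_congr rfl fun i _ => ?_
      rw [Set.indicator_of_mem (hy i (Set.mem_univ i))]
    · rw [Set.indicator_of_notMem hy]
      simp only [Set.mem_pi, Set.mem_univ, true_implies, not_forall] at hy
      obtain ⟨i, hi⟩ := hy
      exact (Finset.prod_eq_zero (Finset.mem_univ i) (Set.indicator_of_notMem hi _)).symm
  rw [h1]
  have hm : ∀ i, Measurable ((s i).indicator (f i)) := fun i => (hf i).indicator (hs i)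
  have hind : iIndepFun (fun i (y : Fin N → ℝ) => (s i).indicator (f i) (y i)) (Measure.pi μ) :=
    iIndepFun_pi (fun i => (hm i).aemeasurable)
  rw [lintegral_prod_eq_prod_lintegral_of_indepFun Finset.univ _ hind
    (fun i => (hm i).comp (measurable_pi_apply i))]
  refine Finset.prod_congr rfl fun i _ => ?_
  rw [(measurePreserving_eval μ i).lintegral_comp (hm i), lintegral_indicator (hs i),
    withDensity_apply _ (hs i)]

lemma gauss_tilt (a : ℝ) : gaussianReal a 1 =
    (gaussianReal 0 1).withDensity (fun x => ENNReal.ofReal (Real.exp (a * x - a ^ 2 / 2))) := by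
  rw [gaussianReal_of_var_ne_zero _ one_ne_zero, gaussianReal_of_var_ne_zero _ one_ne_zero,
    ← withDensity_mul _ (measurable_gaussianPDF _ _) (by fun_prop)]
  congr 1
  funext x
  simp only [gaussianPDF, Pi.mul_apply]
  rw [← ENNReal.ofReal_mul (gaussianPDFReal_nonneg _ _ _)]
  congr 1
  simp only [gaussianPDFReal]
  rw [mul_assoc _ (Real.exp _) (Real.exp _), ← Real.exp_add]
  congr 2
  simp
  ring

lemma gsm_single {N : ℕ} (i : Fin N) (a : ℝ) :
    gsm N (fun j => if j = i then a else 0) 1 =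
      (gsm N 0 1).withDensity (fun y => ENNReal.ofReal (Real.exp (a * y i - a ^ 2 / 2))) := by
  unfold gsm
  simp only [one_pow, Real.toNNReal_one, Pi.zero_apply]
  have : ∀ b : ℝ, IsProbabilityMeasure ((gaussianReal 0 1).withDensity
      (fun x => ENNReal.ofReal (Real.exp (b * x - b ^ 2 / 2)))) := fun b => by
    rw [← gauss_tilt]; infer_instance
  simp_rw [gauss_tilt (if _ = i then a else 0)]
  rw [pi_withDensity_aux (fun _ => gaussianReal 0 1)
    (fun j x => ENNReal.ofReal (Real.exp ((if j = i then a else 0) * x -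
      (if j = i then a else 0) ^ 2 / 2))) (fun j => by fun_prop)]
  congr 1
  funext y
  rw [Finset.prod_eq_single i]
  · simp
  · intro b _ hb; simp [hb]
  · simp

def pm (N : ℕ) (μ : ℝ) (y : Fin N → ℝ) (k : Fin N) : ℝ :=
  μ * (Real.exp (μ * y k) - Real.exp (-(μ * y k))) /
    ∑ i, (Real.exp (μ * y i) + Real.exp (-(μ * y i)))

lemma pm_meas (N : ℕ) (μ : ℝ) : Measurable (pm N μ) := by
  refine measurable_pi_lambda _ fun k => ?_
  unfold pm
  fun_prop

lemma quad_min {N : ℕ} (μ : ℝ) (p q : Fin N → ℝ) (hp : ∀ i, 0 < p i) (hq : ∀ i, 0 < q i)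
    (k : Fin N) (a b : ℝ) (hb : b = μ * (p k - q k) / ∑ i, (p i + q i)) :
    ∑ i, (p i * (b - if k = i then μ else 0) ^ 2 + q i * (b - if k = i then -μ else 0) ^ 2) ≤
    ∑ i, (p i * (a - if k = i then μ else 0) ^ 2 + q i * (a - if k = i then -μ else 0) ^ 2) := by
  have hW : 0 < ∑ i, (p i + q i) :=
    Finset.sum_pos (fun i _ => add_pos (hp i) (hq i)) ⟨k, Finset.mem_univ k⟩
  have key : ∀ x : ℝ,
      ∑ i, (p i * (x - if k = i then μ else 0) ^ 2 + q i * (x - if k = i then -μ else 0) ^ 2) =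
      (∑ i, (p i + q i)) * x ^ 2 - 2 * x * (μ * (p k - q k)) + μ ^ 2 * (p k + q k) := by
    intro x
    have : ∀ i, (p i * (x - if k = i then μ else 0) ^ 2 + q i * (x - if k = i then -μ else 0) ^ 2)
        = (p i + q i) * x ^ 2 + if k = i then
          (- 2 * x * (μ * (p i - q i)) + μ ^ 2 * (p i + q i)) else 0 := by
      intro i; split_ifs <;> ring
    simp_rw [this]
    rw [Finset.sum_add_distrib, ← Finset.sum_mul, Finset.sum_ite_eq]
    simp
    ring
  rw [key, key]
  have h2 : μ * (p k - q k) = b * ∑ i, (p i + q i) := by rw [hb]; field_simp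
  rw [h2]
  nlinarith [mul_nonneg hW.le (sq_nonneg (a - b))]

lemma prior_int {N : ℕ} (μ : ℝ) (est : (Fin N → ℝ) → Fin N → ℝ) :
    ∫⁻ θ, risk N 1 est θ ∂(spikePrior N μ) = (2 * (N : ℝ≥0∞))⁻¹ * ∑ i : Fin N,
      (risk N 1 est (fun j => if j = i then μ else 0) +
       risk N 1 est (fun j => if j = i then -μ else 0)) := by
  unfold spikePrior
  rw [lintegral_smul_measure, lintegral_finsetSum_measure]
  simp [lintegral_add_measure]

lemma risk_single {N : ℕ} (i : Fin N) (a : ℝ) (est : (Fin N → ℝ) → Fin N → ℝ)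
    (he : Measurable est) :
    risk N 1 est (fun j => if j = i then a else 0) =
      ∫⁻ y, ENNReal.ofReal (Real.exp (a * y i - a ^ 2 / 2) *
        ∑ k, (est y k - if k = i then a else 0) ^ 2) ∂(gsm N 0 1) := by
  unfold risk
  rw [gsm_single, lintegral_withDensity_eq_lintegral_mul _ (by fun_prop) (by fun_prop)]
  refine lintegral_congr fun y => ?_
  simp only [Pi.mul_apply]
  rw [ENNReal.ofReal_mul (Real.exp_pos _).le]

lemma total_risk {N : ℕ} (μ : ℝ) (est : (Fin N → ℝ) → Fin N → ℝ) (he : Measurable est) :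
    ∑ i : Fin N,
      (risk N 1 est (fun j => if j = i then μ else 0) +
       risk N 1 est (fun j => if j = i then -μ else 0)) =
    ∫⁻ y, ENNReal.ofReal (∑ k, ∑ i,
      (Real.exp (μ * y i - μ ^ 2 / 2) * (est y k - if k = i then μ else 0) ^ 2 +
       Real.exp (-μ * y i - μ ^ 2 / 2) * (est y k - if k = i then -μ else 0) ^ 2))
       ∂(gsm N 0 1) := by
  simp_rw [risk_single _ _ est he]
  rw [Finset.sum_congr rfl (fun i _ => (lintegral_add_left (by fun_prop) _).symm)]
  rw [← lintegral_finsetSum _ (fun i _ => by fun_prop)]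
  refine lintegral_congr fun y => ?_
  rw [Finset.sum_comm, ENNReal.ofReal_sum_of_nonneg (fun i _ => by positivity)]
  refine Finset.sum_congr rfl fun i _ => ?_
  rw [← ENNReal.ofReal_add (by positivity) (by positivity)]
  congr 1
  rw [Finset.sum_add_distrib, Finset.mul_sum, Finset.mul_sum]
  simp

lemma bayes_eq {N : ℕ} (μ : ℝ) : bayesRisk N (spikePrior N μ) =
    (2 * (N : ℝ≥0∞))⁻¹ * ∑ i : Fin N,
      (risk N 1 (pm N μ) (fun j => if j = i then μ else 0) +
       risk N 1 (pm N μ) (fun j => if j = i then -μ else 0)) := by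
  unfold _root_.bayesRisk
  refine le_antisymm ((iInf₂_le (pm N μ) (pm_meas N μ)).trans (prior_int μ _).le) ?_
  refine le_iInf₂ fun est he => ?_
  rw [prior_int, total_risk μ _ (pm_meas N μ), total_risk μ _ he]
  refine mul_le_mul_right (lintegral_mono fun y => ENNReal.ofReal_le_ofReal
    (Finset.sum_le_sum fun k _ => ?_)) _
  refine quad_min μ _ _ (fun i => Real.exp_pos _) (fun i => Real.exp_pos _) k _ _ ?_
  unfold pm
  simp only [sub_eq_add_neg _ (μ ^ 2 / 2), Real.exp_add, ← add_mul, ← Finset.sum_mul, ← sub_mul]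
  rw [← mul_assoc, mul_div_mul_right _ _ (Real.exp_pos _).ne']
  simp

lemma mp_neg {N : ℕ} (i : Fin N) (μ : ℝ) : MeasurePreserving (fun (y : Fin N → ℝ) j => - y j)
    (gsm N (fun j => if j = i then μ else 0) 1) (gsm N (fun j => if j = i then -μ else 0) 1) := by
  unfold gsm
  refine measurePreserving_pi (f := fun _ x => -x) _ _ fun j => ⟨measurable_neg, ?_⟩
  rw [gaussianReal_map_neg]
  congr 1
  dsimp only
  split_ifs <;> simp

lemma mp_perm {N : ℕ} (e : Equiv.Perm (Fin N)) (θ : Fin N → ℝ) :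
    MeasurePreserving (fun (y : Fin N → ℝ) j => y (e j)) (gsm N θ 1) (gsm N (θ ∘ e) 1) := by
  unfold gsm
  have := measurePreserving_arrowCongr' (fun i => gaussianReal (θ i) ((1 ^ 2 : ℝ).toNNReal))
    (fun i => gaussianReal ((θ ∘ e) i) ((1 ^ 2 : ℝ).toNNReal)) e.symm (MeasurableEquiv.refl ℝ)
    (fun i => by
      simp only [Function.comp_apply, Equiv.apply_symm_apply]
      exact MeasurePreserving.id _)
  exact this

lemma pm_neg {N : ℕ} (μ : ℝ) (y : Fin N → ℝ) (k : Fin N) :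
    pm N μ (fun j => - y j) k = - pm N μ y k := by
  unfold pm
  simp only [mul_neg, neg_neg]
  rw [← neg_div, ← mul_neg μ (_ - _), neg_sub]
  simp only [add_comm]

lemma pm_perm {N : ℕ} (μ : ℝ) (y : Fin N → ℝ) (e : Equiv.Perm (Fin N)) (k : Fin N) :
    pm N μ (fun j => y (e j)) k = pm N μ y (e k) := by
  unfold pm
  rw [Equiv.sum_comp e (fun i => Real.exp (μ * y i) + Real.exp (-(μ * y i)))]

lemma risk_neg {N : ℕ} (i : Fin N) (μ : ℝ) :
    risk N 1 (pm N μ) (fun j => if j = i then -μ else 0) =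
    risk N 1 (pm N μ) (fun j => if j = i then μ else 0) := by
  have hm := pm_meas N μ
  unfold risk
  rw [← (mp_neg i μ).lintegral_comp (by fun_prop)]
  refine lintegral_congr fun y => ?_
  congr 1
  refine Finset.sum_congr rfl fun k _ => ?_
  rw [pm_neg]
  dsimp only
  split_ifs <;> ring

lemma risk_perm {N : ℕ} (i i' k k' : Fin N) (μ c : ℝ) (e : Equiv.Perm (Fin N))
    (hi : e i = i') (hk : e k = k') :
    ∫⁻ y, ENNReal.ofReal ((pm N μ y k' - c) ^ 2)
      ∂(gsm N (fun j => if j = i' then μ else 0) 1) =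
    ∫⁻ y, ENNReal.ofReal ((pm N μ y k - c) ^ 2)
      ∂(gsm N (fun j => if j = i then μ else 0) 1) := by
  have hm := pm_meas N μ
  have h := mp_perm e (fun j => if j = i' then μ else 0)
  have h2 : ((fun j => if j = i' then μ else 0) ∘ e) = fun j => if j = i then μ else 0 := by
    funext j
    simp [← hi]
  rw [h2] at h
  rw [← h.lintegral_comp (by fun_prop)]
  refine lintegral_congr fun y => ?_
  rw [pm_perm, hk]

lemma exists_perm (m : ℕ) (i k : Fin (m + 2)) (h : k ≠ i) :
    ∃ e : Equiv.Perm (Fin (m + 2)), e 1 = i ∧ e 0 = k := by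
  refine ⟨(Equiv.swap 0 k).trans (Equiv.swap (Equiv.swap 0 k 1) i), ?_, ?_⟩
  · simp
  · simp only [Equiv.trans_apply, Equiv.swap_apply_left]
    refine Equiv.swap_apply_of_ne_of_ne ?_ h
    intro h1
    have : Equiv.swap 0 k 0 = Equiv.swap 0 k 1 := by simpa using h1
    exact absurd ((Equiv.swap 0 k).injective this) (by simp)

lemma risk_pos (m : ℕ) (μ : ℝ) (i : Fin (m + 2)) :
    risk (m + 2) 1 (pm (m + 2) μ) (fun j => if j = i then μ else 0) =
      (∫⁻ y, ENNReal.ofReal ((postMean1 m μ y - μ) ^ 2)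
          ∂(gsm (m + 2) (fun j => if j = 0 then μ else 0) 1)) +
        ((m : ℝ≥0∞) + 1) *
          ∫⁻ y, ENNReal.ofReal ((postMean1 m μ y) ^ 2)
            ∂(gsm (m + 2) (fun j => if j = 1 then μ else 0) 1) := by
  have hm := pm_meas (m + 2) μ
  have hp : ∀ y, postMean1 m μ y = pm (m + 2) μ y 0 := fun y => rfl
  simp_rw [hp]
  unfold risk
  have h0 : ∀ y : Fin (m + 2) → ℝ, ENNReal.ofReal
      (∑ k, (pm (m + 2) μ y k - if k = i then μ else 0) ^ 2) =
      ∑ k, ENNReal.ofReal ((pm (m + 2) μ y k - if k = i then μ else 0) ^ 2) := fun y =>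
    ENNReal.ofReal_sum_of_nonneg (fun k _ => sq_nonneg _)
  simp_rw [h0]
  rw [lintegral_finsetSum _ (fun k _ => by fun_prop), ← Finset.add_sum_erase _ _ (Finset.mem_univ i)]
  congr 1
  · simp only [if_true]
    exact risk_perm 0 i 0 i μ μ (Equiv.swap 0 i) (by simp) (by simp)
  · rw [Finset.sum_congr rfl (g := fun _ => ∫⁻ y, ENNReal.ofReal ((pm (m + 2) μ y 0) ^ 2)
            ∂(gsm (m + 2) (fun j => if j = 1 then μ else 0) 1))]
    · simp
    · intro k hk
      have hk : k ≠ i := Finset.ne_of_mem_erase hk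
      obtain ⟨e, h1, h2⟩ := exists_perm m i k hk
      simpa [hk] using risk_perm 1 i 0 k μ 0 e h1 h2

/-- Lemma `lem::spike-bayes-risk-decompose`: for dimension `m + 2 ≥ 2`,
`B(π_S^{μ,m}) = E_{μe₁}(θ̂₁ − μ)² + (m−1)·E_{μe₂}(θ̂₁²)`. -/
theorem statement11 (m : ℕ) (μ : ℝ) (hμ : 0 < μ) :
    bayesRisk (m + 2) (spikePrior (m + 2) μ) =
      (∫⁻ y, ENNReal.ofReal ((postMean1 m μ y - μ) ^ 2)
          ∂(gsm (m + 2) (fun j => if j = 0 then μ else 0) 1)) +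
        ((m : ℝ≥0∞) + 1) *
          ∫⁻ y, ENNReal.ofReal ((postMean1 m μ y) ^ 2)
            ∂(gsm (m + 2) (fun j => if j = 1 then μ else 0) 1) := by
  rw [bayes_eq]
  simp_rw [risk_neg, risk_pos]
  rw [Finset.sum_const, Finset.card_univ, Fintype.card_fin, nsmul_eq_mul, ← two_mul, ← mul_assoc,
    ← mul_assoc, mul_assoc (2 * _)⁻¹, mul_comm ((m + 2 : ℕ) : ℝ≥0∞) 2,
    ENNReal.inv_mul_cancel, one_mul]
  · simp
  · exact ENNReal.mul_ne_top (by simp) (ENNReal.natCast_ne_top _)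
end
end

section
/- Consider the unit-noise Gaussian sequence model on ℝᵐ and the symmetric spike prior π_S^{μ,m}. For sequences μₙ → 0 and mₙ → ∞, the Bayes risk satisfies the lower bound B(π_S^{μₙ,mₙ}) ≥ μₙ² − (μₙ⁴/mₙ)(1+o(1)); that is, there exists a sequence cₙ → 1 such that B(π_S^{μₙ,mₙ}) ≥ μₙ² − (μₙ⁴/mₙ)·cₙ for all n. -/
open MeasureTheory ProbabilityTheory Filter
open scoped ENNReal NNReal Topology

noncomputable section

/-- Likelihood ratio in one coordinate. -/
def lrat (a x : ℝ) : ℝ := Real.exp (a * x - a ^ 2 / 2)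

lemma measurable_lrat (a : ℝ) : Measurable (lrat a) := by
  unfold lrat; fun_prop

lemma gauss_shift (a : ℝ) :
    gaussianReal a 1 = (gaussianReal 0 1).withDensity (fun x => ENNReal.ofReal (lrat a x)) := by
  rw [gaussianReal_of_var_ne_zero _ one_ne_zero, gaussianReal_of_var_ne_zero _ one_ne_zero,
    ← withDensity_mul _ (measurable_gaussianPDF _ _) (measurable_lrat a).ennreal_ofReal]
  congr 1
  ext x
  simp only [Pi.mul_apply, gaussianPDF]
  rw [← ENNReal.ofReal_mul (gaussianPDFReal_nonneg _ _ _)]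
  congr 1
  simp only [gaussianPDFReal, lrat]
  rw [mul_assoc (√_)⁻¹, ← Real.exp_add]
  congr 2
  push_cast
  ring

lemma gsm_shift (m : ℕ) (i : Fin m) (a : ℝ) :
    gsm m (fun j => if j = i then a else 0) 1 =
      (gsm m 0 1).withDensity (fun y => ENNReal.ofReal (lrat a (y i))) := by
  unfold gsm
  have h1 : ((1 : ℝ) ^ 2).toNNReal = 1 := by simp
  simp only [h1, Pi.zero_apply]
  refine Measure.pi_eq fun s hs => ?_
  rw [withDensity_apply _ (MeasurableSet.univ_pi hs), ← lintegral_indicator (MeasurableSet.univ_pi hs)]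
  set h : Fin m → ℝ → ℝ≥0∞ := fun j =>
    (s j).indicator (fun x => if j = i then ENNReal.ofReal (lrat a x) else 1) with hh
  have hmeas : ∀ j, Measurable (h j) := by
    intro j
    refine Measurable.indicator ?_ (hs j)
    by_cases hj : j = i
    · simp only [hj, if_true]; exact (measurable_lrat a).ennreal_ofReal
    · simp only [hj, if_false]; exact measurable_const
  have hprod : ∀ y : Fin m → ℝ, (Set.univ.pi s).indicator
      (fun y : Fin m → ℝ => ENNReal.ofReal (lrat a (y i))) y = ∏ j, h j (y j) := by
    intro y
    by_cases hy : y ∈ Set.univ.pi s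
    · rw [Set.indicator_of_mem hy]
      have : ∀ j, h j (y j) = if j = i then ENNReal.ofReal (lrat a (y j)) else 1 := by
        intro j
        simp only [hh]
        rw [Set.indicator_of_mem (hy j (Set.mem_univ j))]
      simp [this]
    · rw [Set.indicator_of_notMem hy]
      simp only [Set.mem_pi, Set.mem_univ, true_imp_iff, not_forall] at hy
      obtain ⟨j, hj⟩ := hy
      symm
      apply Finset.prod_eq_zero (Finset.mem_univ j)
      simp only [hh]
      rw [Set.indicator_of_notMem hj]
  simp_rw [hprod]
  have hind := iIndepFun_pi (μ := fun _ : Fin m => gaussianReal 0 1) (X := h)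
    (fun j => (hmeas j).aemeasurable)
  rw [lintegral_prod_eq_prod_lintegral_of_indepFun Finset.univ _ hind
    (fun j => (hmeas j).comp (measurable_pi_apply j))]
  refine Finset.prod_congr rfl fun j _ => ?_
  rw [(measurePreserving_eval (fun _ : Fin m => gaussianReal 0 1) j).lintegral_comp (hmeas j)]
  simp only [hh]
  rw [lintegral_indicator (hs j)]
  by_cases hj : j = i
  · simp only [hj, if_true]
    rw [gauss_shift a, withDensity_apply _ (hj ▸ hs j)]
  · simp [hj]

/-- The per-coordinate lower bound. -/
def uu (m : ℕ) (μ x : ℝ) : ℝ :=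
  μ ^ 2 / (2 * m) * (lrat μ x + lrat (-μ) x) -
    μ ^ 2 / m ^ 2 * Real.exp (μ ^ 2 / 2) * ((lrat μ x - lrat (-μ) x) / 2) ^ 2

/-- Error constant. -/
def cc (μ : ℝ) : ℝ := Real.exp (-(μ ^ 2) / 2) * ((Real.exp (2 * μ ^ 2) - 1) / (2 * μ ^ 2))

lemma uu_eq (m : ℕ) (μ x : ℝ) : uu m μ x =
    μ ^ 2 / (2 * m) * Real.exp (-(μ ^ 2) / 2) * (Real.exp (μ * x) + Real.exp (-μ * x)) -
    μ ^ 2 / m ^ 2 * Real.exp (-(μ ^ 2) / 2) / 4 *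
      (Real.exp (2 * μ * x) + Real.exp (-2 * μ * x) - 2) := by
  have e1 : lrat μ x = Real.exp (-(μ ^ 2) / 2) * Real.exp (μ * x) := by
    rw [lrat, ← Real.exp_add]; congr 1; ring
  have e2 : lrat (-μ) x = Real.exp (-(μ ^ 2) / 2) * Real.exp (-μ * x) := by
    rw [lrat, ← Real.exp_add]; congr 1; ring
  have e3 : Real.exp (2 * μ * x) = Real.exp (μ * x) ^ 2 := by
    rw [← Real.exp_nat_mul]; congr 1; push_cast; ring
  have e4 : Real.exp (-2 * μ * x) = Real.exp (-μ * x) ^ 2 := by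
    rw [← Real.exp_nat_mul]; congr 1; push_cast; ring
  have e5 : Real.exp (μ * x) * Real.exp (-μ * x) = 1 := by
    rw [← Real.exp_add]; simp
  have e6 : Real.exp (μ ^ 2 / 2) * Real.exp (-(μ ^ 2) / 2) = 1 := by
    rw [← Real.exp_add]; ring_nf; simp
  rw [uu, e1, e2, e3, e4]
  linear_combination (-(μ ^ 2 / m ^ 2) * Real.exp (-(μ ^ 2) / 2) / 4 *
      (Real.exp (μ * x) - Real.exp (-μ * x)) ^ 2) * e6 +
      (μ ^ 2 / m ^ 2 * Real.exp (-(μ ^ 2) / 2) / 2) * e5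

lemma int_exp (t : ℝ) : ∫ x, Real.exp (t * x) ∂(gaussianReal 0 1) = Real.exp (t ^ 2 / 2) := by
  have := congrFun (mgf_id_gaussianReal (μ := 0) (v := 1)) t
  simpa [mgf] using this

lemma uu_integrable (m : ℕ) (μ : ℝ) : Integrable (uu m μ) (gaussianReal 0 1) := by
  have : uu m μ = _ := funext (uu_eq m μ)
  rw [this]
  have h := fun t => integrable_exp_mul_gaussianReal (μ := 0) (v := 1) t
  exact (((h _).add (h _)).const_mul _).sub ((((h _).add (h _)).sub (integrable_const _)).const_mul _)

lemma uu_integral (m : ℕ) (hm : 1 ≤ m) (μ : ℝ) (hμ : 0 < μ) :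
    ∫ x, uu m μ x ∂(gaussianReal 0 1) = (μ ^ 2 - μ ^ 4 / m * cc μ) / m := by
  have h := fun t => integrable_exp_mul_gaussianReal (μ := 0) (v := 1) t
  have h2 : ∀ s t, Integrable (fun x => Real.exp (s * x) + Real.exp (t * x)) (gaussianReal 0 1) :=
    fun s t => (h s).add (h t)
  have h3 : ∀ s t, Integrable (fun x => Real.exp (s * x) + Real.exp (t * x) - 2)
      (gaussianReal 0 1) := fun s t => (h2 s t).sub (integrable_const _)
  simp_rw [uu_eq]
  rw [integral_sub ((h2 _ _).const_mul _) ((h3 _ _).const_mul _),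
    integral_const_mul, integral_const_mul, integral_sub (h2 _ _) (integrable_const _),
    integral_add (h _) (h _), integral_add (h _) (h _)]
  simp only [int_exp, integral_const, probReal_univ, one_smul]
  have e6 : Real.exp (μ ^ 2 / 2) * Real.exp (-(μ ^ 2) / 2) = 1 := by
    rw [← Real.exp_add]; ring_nf; simp
  have e7 : (-μ) ^ 2 = μ ^ 2 := by ring
  have e8 : (2 * μ) ^ 2 / 2 = 2 * μ ^ 2 := by ring
  have e9 : (-2 * μ) ^ 2 / 2 = 2 * μ ^ 2 := by ring
  rw [e7, e8, e9, cc]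
  have hm' : (m : ℝ) ≠ 0 := by positivity
  have hc : μ ^ 4 / m * (Real.exp (-(μ ^ 2) / 2) * ((Real.exp (2 * μ ^ 2) - 1) / (2 * μ ^ 2)))
     = μ ^ 2 / m * Real.exp (-(μ ^ 2) / 2) * (Real.exp (2 * μ ^ 2) - 1) / 2 := by
    field_simp
  rw [hc]
  have hA : μ ^ 2 / (2 * m) * Real.exp (-(μ ^ 2) / 2) * (Real.exp (μ ^ 2 / 2) + Real.exp (μ ^ 2 / 2))
     = μ ^ 2 / m := by
    linear_combination (μ ^ 2 / m) * e6
  rw [hA]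
  field_simp
  ring

/-- Pointwise bound. -/
lemma pointwise (m : ℕ) (hm : 1 ≤ m) (μ : ℝ) (y a : Fin m → ℝ) :
    ∑ i, uu m μ (y i) ≤ (2 * (m : ℝ))⁻¹ * ∑ i,
      (lrat μ (y i) * ∑ j, (a j - if j = i then μ else 0) ^ 2 +
        lrat (-μ) (y i) * ∑ j, (a j - if j = i then -μ else 0) ^ 2) := by
  have hm' : (0 : ℝ) < m := by exact_mod_cast hm
  have hs : ∀ (i : Fin m) (b : ℝ), ∑ j, (a j - if j = i then b else 0) ^ 2
      = (∑ j, a j ^ 2) - 2 * b * a i + b ^ 2 := by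
    intro i b
    have : ∀ j, (a j - if j = i then b else 0) ^ 2 =
        a j ^ 2 + (if j = i then (- 2 * b * a i + b ^ 2) else 0) := by
      intro j
      split_ifs with h
      · rw [h]; ring
      · ring
    simp_rw [this, Finset.sum_add_distrib]
    simp
    ring
  simp_rw [hs]
  set A := ∑ j, a j ^ 2 with hA
  have hA' : A = ∑ i : Fin m, (m : ℝ)⁻¹ * A := by
    simp; field_simp
  have hk : ∀ x, 2 * Real.exp (-(μ ^ 2) / 2) ≤ lrat μ x + lrat (-μ) x := by
    intro x
    have e1 : lrat μ x = Real.exp (-(μ ^ 2) / 2) * Real.exp (μ * x) := by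
      rw [lrat, ← Real.exp_add]; congr 1; ring
    have e2 : lrat (-μ) x = Real.exp (-(μ ^ 2) / 2) * Real.exp (-(μ * x)) := by
      rw [lrat, ← Real.exp_add]; congr 1; ring
    have := Real.one_le_cosh (μ * x)
    rw [Real.cosh_eq] at this
    rw [e1, e2]
    nlinarith [Real.exp_pos (-(μ ^ 2) / 2)]
  set k := Real.exp (-(μ ^ 2) / 2) with hkdef
  have hk0 : 0 < k := Real.exp_pos _
  have hkinv : Real.exp (μ ^ 2 / 2) = k⁻¹ := by
    rw [hkdef, ← Real.exp_neg]; congr 1; ring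
  have hA0 : 0 ≤ A := Finset.sum_nonneg fun _ _ => sq_nonneg _
  have step1 : ∀ i, (2 * (m : ℝ))⁻¹ * (2 * k * A) +
      (2 * (m : ℝ))⁻¹ * (μ ^ 2 * (lrat μ (y i) + lrat (-μ) (y i)) -
        2 * μ * a i * (lrat μ (y i) - lrat (-μ) (y i))) ≤
      (2 * (m : ℝ))⁻¹ * (lrat μ (y i) * (A - 2 * μ * a i + μ ^ 2) +
        lrat (-μ) (y i) * (A - 2 * (-μ) * a i + (-μ) ^ 2)) := by
    intro i
    rw [← mul_add]
    apply mul_le_mul_of_nonneg_left _ (by positivity)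
    nlinarith [mul_le_mul_of_nonneg_right (hk (y i)) hA0]
  rw [Finset.mul_sum]
  refine le_trans ?_ (Finset.sum_le_sum fun i _ => step1 i)
  rw [Finset.sum_add_distrib]
  have hkA : ∑ i : Fin m, (2 * (m : ℝ))⁻¹ * (2 * k * A) = ∑ i, k * a i ^ 2 := by
    rw [← Finset.mul_sum Finset.univ (fun i => a i ^ 2) k, ← hA]; simp; field_simp
  rw [hkA, ← Finset.sum_add_distrib]
  apply Finset.sum_le_sum
  intro i _
  rw [uu, hkinv]
  set D := lrat μ (y i) - lrat (-μ) (y i)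
  have : k * a i ^ 2 - (2 * (m : ℝ))⁻¹ * (2 * μ * a i * D) + μ ^ 2 / m ^ 2 * k⁻¹ * (D / 2) ^ 2
     = k * (a i - μ * D / (2 * m * k)) ^ 2 := by
    field_simp
    ring
  have h2 : 0 ≤ k * (a i - μ * D / (2 * m * k)) ^ 2 := by positivity
  rw [← this] at h2
  have h3 : μ ^ 2 / (2 * m) = (2 * (m : ℝ))⁻¹ * μ ^ 2 := by field_simp
  rw [h3]
  linarith

lemma ofReal_integral_le' {α : Type*} [MeasurableSpace α] (P : Measure α) (g : α → ℝ)
    (hg : Integrable g P) : ENNReal.ofReal (∫ x, g x ∂P) ≤ ∫⁻ x, ENNReal.ofReal (g x) ∂P := by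
  rw [integral_eq_lintegral_pos_part_sub_lintegral_neg_part hg]
  refine le_trans (ENNReal.ofReal_le_ofReal (sub_le_self _ ENNReal.toReal_nonneg)) ?_
  exact ENNReal.ofReal_toReal_le

lemma risk_shift (m : ℕ) (i : Fin m) (b : ℝ) (est : (Fin m → ℝ) → Fin m → ℝ)
    (hest : Measurable est) :
    risk m 1 est (fun j => if j = i then b else 0) =
      ∫⁻ y, ENNReal.ofReal (lrat b (y i) * ∑ j, (est y j - if j = i then b else 0) ^ 2)
        ∂(gsm m 0 1) := by
  have hme : ∀ j, Measurable fun y => est y j := fun j => (measurable_pi_apply j).comp hest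
  have hml : Measurable fun y : Fin m → ℝ => lrat b (y i) :=
    (measurable_lrat b).comp (measurable_pi_apply i)
  unfold risk
  rw [gsm_shift, lintegral_withDensity_eq_lintegral_mul _ hml.ennreal_ofReal]
  · apply lintegral_congr
    intro y
    rw [Pi.mul_apply, ← ENNReal.ofReal_mul (show 0 ≤ lrat b (y i) from (Real.exp_pos _).le)]
  · apply Measurable.ennreal_ofReal
    exact Finset.measurable_sum _ fun j _ => ((hme j).sub measurable_const).pow_const 2

lemma main_bound (m : ℕ) (hm : 1 ≤ m) (μ : ℝ) (hμ : 0 < μ) :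
    ENNReal.ofReal (μ ^ 2 - μ ^ 4 / m * cc μ) ≤ bayesRisk m (spikePrior m μ) := by
  unfold _root_.bayesRisk
  refine le_iInf₂ fun est hest => ?_
  have hme : ∀ j, Measurable fun y => est y j := fun j => (measurable_pi_apply j).comp hest
  have hml : ∀ b i, Measurable fun y : Fin m → ℝ => lrat b (y i) := fun b i =>
    (measurable_lrat b).comp (measurable_pi_apply i)
  have hmS : ∀ b i, Measurable fun y : Fin m → ℝ =>
      ENNReal.ofReal (lrat b (y i) * ∑ j, (est y j - if j = i then b else 0) ^ 2) := by
    intro b i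
    exact ((hml b i).mul
      (Finset.measurable_sum _ fun j _ => ((hme j).sub measurable_const).pow_const 2)).ennreal_ofReal
  have hm' : (0 : ℝ) < m := by exact_mod_cast hm
  have hconst : (2 * (m : ℝ≥0∞))⁻¹ = ENNReal.ofReal ((2 * (m : ℝ))⁻¹) := by
    rw [ENNReal.ofReal_inv_of_pos (by positivity), ENNReal.ofReal_mul (by norm_num)]
    simp
  have hL0 : ∀ b x, 0 ≤ lrat b x := fun b x => (Real.exp_pos _).le
  have hterm0 : ∀ b (i : Fin m) (y : Fin m → ℝ),
      0 ≤ lrat b (y i) * ∑ j, (est y j - if j = i then b else 0) ^ 2 := fun b i y =>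
    mul_nonneg (hL0 _ _) (Finset.sum_nonneg fun _ _ => sq_nonneg _)
  have hmT : ∀ i, Measurable fun y : Fin m → ℝ =>
      ENNReal.ofReal (lrat μ (y i) * ∑ j, (est y j - if j = i then μ else 0) ^ 2) +
      ENNReal.ofReal (lrat (-μ) (y i) * ∑ j, (est y j - if j = i then -μ else 0) ^ 2) :=
    fun i => (hmS μ i).add (hmS (-μ) i)
  have hrhs : ∫⁻ θ, risk m 1 est θ ∂(spikePrior m μ) =
      ∫⁻ y, ENNReal.ofReal ((2 * (m : ℝ))⁻¹ * ∑ i,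
      (lrat μ (y i) * ∑ j, (est y j - if j = i then μ else 0) ^ 2 +
        lrat (-μ) (y i) * ∑ j, (est y j - if j = i then -μ else 0) ^ 2)) ∂(gsm m 0 1) := by
    unfold spikePrior
    rw [lintegral_smul_measure, lintegral_finsetSum_measure]
    simp_rw [lintegral_add_measure, lintegral_dirac, risk_shift m _ _ est hest]
    simp_rw [← lintegral_add_left (hmS μ _)]
    rw [← lintegral_finsetSum _ fun i _ => hmT i, smul_eq_mul,
      ← lintegral_const_mul _ (Finset.measurable_sum _ fun i _ => hmT i)]
    apply lintegral_congr
    intro y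
    rw [ENNReal.ofReal_mul (by positivity), hconst,
      ENNReal.ofReal_sum_of_nonneg fun i _ => add_nonneg (hterm0 _ _ _) (hterm0 _ _ _)]
    congr 1
    refine Finset.sum_congr rfl fun i _ => ?_
    rw [ENNReal.ofReal_add (hterm0 _ _ _) (hterm0 _ _ _)]
  rw [hrhs]
  have hP : gsm m 0 1 = Measure.pi fun _ : Fin m => gaussianReal 0 1 := by
    unfold gsm; simp
  have hpres : ∀ i, MeasurePreserving (Function.eval i) (gsm m 0 1) (gaussianReal 0 1) := by
    intro i
    rw [hP]; exact measurePreserving_eval (fun _ : Fin m => gaussianReal 0 1) i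
  have hint : ∀ i, Integrable (fun y : Fin m → ℝ => uu m μ (y i)) (gsm m 0 1) := fun i =>
    (hpres i).integrable_comp_of_integrable (uu_integrable m μ)
  have hval : ∀ i, ∫ y : Fin m → ℝ, uu m μ (y i) ∂(gsm m 0 1) = (μ ^ 2 - μ ^ 4 / m * cc μ) / m := by
    intro i
    rw [← uu_integral m hm μ hμ, ← (hpres i).map_eq, integral_map (hpres i).aemeasurable]
    rw [(hpres i).map_eq]; exact (uu_integrable m μ).aestronglyMeasurable
  have htot : ∫ y : Fin m → ℝ, ∑ i, uu m μ (y i) ∂(gsm m 0 1) = μ ^ 2 - μ ^ 4 / m * cc μ := by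
    rw [integral_finsetSum _ fun i _ => hint i]
    simp_rw [hval]
    simp
    field_simp
  rw [← htot]
  refine (ofReal_integral_le' _ _ (integrable_finsetSum _ fun i _ => hint i)).trans ?_
  exact lintegral_mono fun y => ENNReal.ofReal_le_ofReal (pointwise m hm μ y (est y))

lemma cc_tendsto (μ : ℕ → ℝ) (hμpos : ∀ n, 0 < μ n) (hμ0 : Tendsto μ atTop (𝓝 0)) :
    Tendsto (fun n => cc (μ n)) atTop (𝓝 1) := by
  have h1 : Tendsto (fun n => Real.exp (-(μ n ^ 2) / 2)) atTop (𝓝 1) := by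
    have hc : Continuous fun x : ℝ => Real.exp (-(x ^ 2) / 2) := by fun_prop
    simpa [Function.comp_def] using (hc.tendsto 0).comp hμ0
  have h2 : Tendsto (fun n => 2 * μ n ^ 2) atTop (𝓝[≠] 0) := by
    apply tendsto_nhdsWithin_iff.2
    refine ⟨?_, Eventually.of_forall fun n => ?_⟩
    · have hc : Continuous fun x : ℝ => 2 * x ^ 2 := by fun_prop
      simpa [Function.comp_def] using (hc.tendsto 0).comp hμ0
    · have := hμpos n
      simp only [Set.mem_compl_iff, Set.mem_singleton_iff]
      positivity
  have h3 := (Real.hasDerivAt_exp 0).tendsto_slope_zero.comp h2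
  have h4 : Tendsto (fun n => (Real.exp (2 * μ n ^ 2) - 1) / (2 * μ n ^ 2)) atTop (𝓝 1) := by
    refine (h3.congr fun n => ?_).trans (by simp)
    simp [div_eq_inv_mul]
  simpa [cc] using h1.mul h4

/-- Lemma `lem::spike-bayes-risk-regime-1`:
as `μₙ → 0` and `mₙ → ∞`, `B(π_S^{μₙ,mₙ}) ≥ μₙ² − (μₙ⁴/mₙ)(1+o(1))`. -/
theorem statement12
    (m : ℕ → ℕ) (μ : ℕ → ℝ)
    (hm1 : ∀ n, 1 ≤ m n) (hμpos : ∀ n, 0 < μ n)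
    (hμ0 : Tendsto μ atTop (𝓝 0)) (hmtop : Tendsto m atTop atTop) :
    ∃ c : ℕ → ℝ, Tendsto c atTop (𝓝 1) ∧
      ∀ n : ℕ,
        ENNReal.ofReal (μ n ^ 2 - μ n ^ 4 / m n * c n) ≤
          bayesRisk (m n) (spikePrior (m n) (μ n)) := by
  exact ⟨fun n => cc (μ n), cc_tendsto μ hμpos hμ0, fun n => main_bound (m n) (hm1 n) (μ n) (hμpos n)⟩
end
end

section
/- Consider the unit-noise Gaussian sequence model on ℝᵐ and the one-sided spike prior π_S^{μ,m} assigning mass 1/m to each point μeᵢ, i = 1,…,m. Let ν_m = √(2 log m) and set μ = ν_{m−1} − √(2 log ν_{m−1}). Then as m → ∞, the Bayes risk satisfies B(π_S^{μ,m}) ≥ ν_m² − 2 ν_m √(2 log ν_m) (1+o(1)); that is, there exists a sequence c_m → 1 such that B(π_S^{μ,m}) ≥ ν_m² − 2 c_m ν_m √(2 log ν_m) for all large m. -/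
open MeasureTheory ProbabilityTheory Filter
open scoped ENNReal NNReal Topology

noncomputable section

/-- One-sided spike prior: mass `1/m` at each of the `m` points `μ eᵢ`. -/
def spikePriorOneSided (m : ℕ) (μ : ℝ) : Measure (Fin m → ℝ) :=
  ((m : ℝ≥0∞))⁻¹ • ∑ i : Fin m, Measure.dirac (fun j => if j = i then μ else 0)

/-- `ν_m = √(2 log m)`. -/
def nuSeq (m : ℕ) : ℝ := Real.sqrt (2 * Real.log m)

lemma pointwise_aux (f F g G e μ l ft : ℝ) (hf : 0 < f) (hg : 0 ≤ g) (hgG : g ≤ G)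
    (hft : ft = 0 ∨ (ft = f ∧ f ≤ F)) :
    μ ^ 2 * (ft * (2 * l * g - l ^ 2 * (g * (F + g)))) ≤ f * (e - μ) ^ 2 + e ^ 2 * G := by
  rcases hft with h | ⟨h, hF⟩
  · subst h
    have : 0 ≤ G := hg.trans hgG
    have : 0 ≤ f * (e - μ) ^ 2 + e ^ 2 * G := by positivity
    simpa using this
  · subst h
    have h1 : ft * (e - μ) ^ 2 + e ^ 2 * g ≤ ft * (e - μ) ^ 2 + e ^ 2 * G := by gcongr
    refine le_trans ?_ h1
    have hpos : 0 < ft + g := by linarith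
    have h2 : μ ^ 2 * (ft * g) ≤ (ft + g) * (ft * (e - μ) ^ 2 + e ^ 2 * g) := by
      nlinarith [sq_nonneg (ft * (e - μ) + e * g)]
    have h3 : (ft + g) * (2 * l * g - l ^ 2 * (g * (F + g))) ≤ g := by
      have h4 : (ft + g) * (2 * l * g - l ^ 2 * (g * (F + g)))
          ≤ (ft + g) * (2 * l * g - l ^ 2 * (g * (ft + g))) := by gcongr
      nlinarith [mul_nonneg hg (sq_nonneg (1 - l * (ft + g)))]
    have h5 : (ft + g) * (μ ^ 2 * (ft * (2 * l * g - l ^ 2 * (g * (F + g))))) ≤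
        (ft + g) * (ft * (e - μ) ^ 2 + e ^ 2 * g) := by
      refine le_trans ?_ h2
      have : 0 ≤ μ ^ 2 * ft := by positivity
      nlinarith [mul_le_mul_of_nonneg_left h3 this]
    exact le_of_mul_le_mul_left h5 hpos

lemma moment_aux {Ω ι : Type*} [MeasurableSpace Ω] [Fintype ι] [DecidableEq ι] (P : Measure Ω)
    [IsProbabilityMeasure P] (X : ι → Ω → ℝ) (hX : iIndepFun X P) (hm : ∀ i, Measurable (X i))
    (F q b n : ℝ) (h0 : ∀ i ω, 0 ≤ X i ω) (hF : ∀ i ω, X i ω ≤ F) (hq : ∀ i, ∫ ω, X i ω ∂P = q)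
    (hq0 : 0 ≤ q) (hn : 0 < n) (j : ι) (hcard : ((Finset.univ.erase j).card : ℝ) = n)
    (hb : F = n * b) :
    Integrable (fun ω => X j ω * (2 * (1 / n) * (∑ i ∈ Finset.univ.erase j, X i ω) - (1 / n) ^ 2 *
      ((∑ i ∈ Finset.univ.erase j, X i ω) * (F + ∑ i ∈ Finset.univ.erase j, X i ω)))) P ∧
    q ^ 2 * (2 - 2 * b - q) ≤
    ∫ ω, X j ω * (2 * (1 / n) * (∑ i ∈ Finset.univ.erase j, X i ω) - (1 / n) ^ 2 *
      ((∑ i ∈ Finset.univ.erase j, X i ω) * (F + ∑ i ∈ Finset.univ.erase j, X i ω))) ∂P := by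
  set s := Finset.univ.erase j with hs
  set G : Ω → ℝ := ∑ i ∈ s, X i with hG
  have hGe : ∀ ω, ∑ i ∈ s, X i ω = G ω := fun ω => by simp [hG]
  simp only [hGe]
  have hGm : Measurable G := by
    have : G = fun ω => ∑ i ∈ s, X i ω := by funext ω; simp [hG]
    rw [this]; exact Finset.measurable_sum _ (fun i _ => hm i)
  have hLp : ∀ i, MemLp (X i) 2 P := fun i =>
    MemLp.of_bound (hm i).aestronglyMeasurable F
      (ae_of_all _ fun ω => by rw [Real.norm_eq_abs, abs_of_nonneg (h0 i ω)]; exact hF i ω)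
  have hGL : MemLp G 2 P := memLp_finsetSum' _ (fun i _ => hLp i)
  have hXi : ∀ i, Integrable (X i) P := fun i => (hLp i).integrable (by norm_num)
  have hGi : Integrable G P := hGL.integrable (by norm_num)
  have hG2 : Integrable (fun ω => G ω ^ 2) P := hGL.integrable_sq
  have hind : IndepFun G (X j) P := hX.indepFun_finsetSum_of_notMem hm (by simp [hs])
  let φ : ℝ → ℝ := fun g => 2 * (1 / n) * g - (1 / n) ^ 2 * (g * (F + g))
  have hφ : Measurable φ := by fun_prop
  have hind2 : IndepFun (X j) (fun ω => φ (G ω)) P := hind.symm.comp measurable_id hφ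
  have hφe : (fun ω => φ (G ω)) = fun ω =>
      (2 * (1 / n) - (1/n)^2 * F) * G ω - (1 / n) ^ 2 * G ω ^ 2 := by
    funext ω; simp only [φ]; ring
  have hφi : Integrable (fun ω => φ (G ω)) P := by
    rw [hφe]; exact (hGi.const_mul _).sub (hG2.const_mul _)
  refine ⟨hind2.integrable_mul (hXi j) hφi, ?_⟩
  have e1 : ∫ ω, X j ω * φ (G ω) ∂P = q * ∫ ω, φ (G ω) ∂P := by
    rw [← hq j]
    exact hind2.integral_fun_mul_eq_mul_integral (hm j).aestronglyMeasurable
      (hφ.comp hGm).aestronglyMeasurable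
  have e2 : ∫ ω, G ω ∂P = n * q := by
    have : G = fun ω => ∑ i ∈ s, X i ω := by funext ω; simp [hG]
    rw [this, integral_finsetSum _ (fun i _ => hXi i)]
    simp [hq, hcard]
  have e3 : ∫ ω, G ω ^ 2 ∂P ≤ n * (F * q) + (n * q) ^ 2 := by
    have hv : Var[G; P] = ∑ i ∈ s, Var[X i; P] :=
      IndepFun.variance_sum (fun i _ => hLp i) (fun i _ k _ hik => hX.indepFun hik)
    have hv2 : ∀ i, Var[X i; P] ≤ F * q := fun i => by
      refine (variance_le_expectation_sq (hm i).aestronglyMeasurable).trans ?_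
      rw [← hq i, ← integral_const_mul]
      refine integral_mono (hLp i).integrable_sq ((hXi i).const_mul _) (fun ω => ?_)
      simp only [Pi.pow_apply]
      nlinarith [h0 i ω, hF i ω]
    have hv3 : ∑ i ∈ s, Var[X i; P] ≤ n * (F * q) := by
      refine (Finset.sum_le_card_nsmul s _ _ (fun i _ => hv2 i)).trans ?_
      rw [nsmul_eq_mul, hcard]
    have hv4 := variance_eq_sub hGL
    simp only [Pi.pow_apply, e2] at hv4
    linarith
  have e4 : ∫ ω, φ (G ω) ∂P ≥ q * (2 - 2 * b - q) := by
    rw [hφe, integral_sub (hGi.const_mul _) (hG2.const_mul _), integral_const_mul,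
      integral_const_mul, e2]
    have : (1 / n) ^ 2 * ∫ ω, G ω ^ 2 ∂P ≤ (1 / n) ^ 2 * (n * (F * q) + (n * q) ^ 2) := by gcongr
    have e5 : (2 * (1 / n) - (1 / n) ^ 2 * F) * (n * q) - (1 / n) ^ 2 * (n * (F * q) + (n * q) ^ 2)
        = q * (2 - 2 * b - q) := by
      subst hb; field_simp; ring
    linarith
  change _ ≤ ∫ ω, X j ω * φ (G ω) ∂P
  rw [e1]
  nlinarith [mul_le_mul_of_nonneg_left e4 hq0]

lemma ofReal_int_le {Ω : Type*} [MeasurableSpace Ω] (P : Measure Ω) (h : Ω → ℝ)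
    (hi : Integrable h P) : ENNReal.ofReal (∫ ω, h ω ∂P) ≤ ∫⁻ ω, ENNReal.ofReal (h ω) ∂P := by
  have h1 : ∫ ω, h ω ∂P ≤ ∫ ω, max (h ω) 0 ∂P :=
    integral_mono hi hi.pos_part (fun ω => le_max_left _ _)
  refine (ENNReal.ofReal_le_ofReal h1).trans ?_
  rw [ofReal_integral_eq_lintegral_ofReal hi.pos_part (ae_of_all _ fun ω => le_max_right _ _)]
  refine lintegral_mono fun ω => ?_
  simp

lemma gauss_density (μ : ℝ) : gaussianReal μ 1 =
    (gaussianReal 0 1).withDensity (fun x => ENNReal.ofReal (Real.exp (μ * x - μ ^ 2 / 2))) := by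
  rw [gaussianReal_of_var_ne_zero _ one_ne_zero, gaussianReal_of_var_ne_zero _ one_ne_zero,
    ← withDensity_mul _ (measurable_gaussianPDF _ _) (by fun_prop)]
  congr 1
  funext x
  simp only [Pi.mul_apply, gaussianPDF, gaussianPDFReal]
  rw [← ENNReal.ofReal_mul (by positivity), mul_assoc _ (Real.exp _), ← Real.exp_add]
  congr 3
  simp
  ring

lemma gsm_density (m : ℕ) (μ : ℝ) (i : Fin m) :
    gsm m (fun j => if j = i then μ else 0) 1 =
    (gsm m 0 1).withDensity (fun y => ENNReal.ofReal (Real.exp (μ * y i - μ ^ 2 / 2))) := by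
  unfold gsm
  simp only [one_pow, Real.toNNReal_one, Pi.zero_apply]
  refine (Measure.pi_eq fun s hs => ?_)
  rw [withDensity_apply _ (MeasurableSet.univ_pi hs), ← lintegral_indicator (MeasurableSet.univ_pi hs)]
  let g : Fin m → ℝ → ℝ≥0∞ := fun j => (s j).indicator
    (fun x => if j = i then ENNReal.ofReal (Real.exp (μ * x - μ ^ 2 / 2)) else 1)
  have hg : ∀ j, Measurable (g j) := fun j => by
    refine Measurable.indicator ?_ (hs j)
    split_ifs <;> fun_prop
  have h1 : ∀ y : Fin m → ℝ, (Set.univ.pi s).indicator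
      (fun y => ENNReal.ofReal (Real.exp (μ * y i - μ ^ 2 / 2))) y = ∏ j, g j (y j) := by
    intro y
    by_cases hy : y ∈ Set.univ.pi s
    · rw [Set.indicator_of_mem hy]
      have : ∀ j, g j (y j) = if j = i then ENNReal.ofReal (Real.exp (μ * y j - μ ^ 2 / 2)) else 1 :=
        fun j => Set.indicator_of_mem (hy j trivial) _
      simp [this]
    · rw [Set.indicator_of_notMem hy]
      simp only [Set.mem_pi, Set.mem_univ, true_imp_iff, not_forall] at hy
      obtain ⟨j, hj⟩ := hy
      exact (Finset.prod_eq_zero (Finset.mem_univ j) (Set.indicator_of_notMem hj _)).symm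
  rw [lintegral_congr h1]
  have h3 := lintegral_prod_eq_prod_lintegral_of_indepFun
    (μ := Measure.pi fun _ : Fin m => gaussianReal 0 1) Finset.univ
    (fun j (y : Fin m → ℝ) => g j (y j))
    (iIndepFun_pi fun j => (hg j).aemeasurable) (fun j => (hg j).comp (measurable_pi_apply j))
  rw [h3]
  refine Finset.prod_congr rfl fun j _ => ?_
  have h2 := (measurePreserving_eval (fun _ : Fin m => gaussianReal 0 1) j).lintegral_comp (hg j)
  simp only [Function.eval] at h2
  rw [h2, lintegral_indicator (hs j)]
  by_cases hji : j = i
  · simp only [hji, if_true]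
    rw [gauss_density μ, withDensity_apply _ (hji ▸ hs j)]
  · simp [hji]

/-- The truncated likelihood ratio. -/
def ftr (μ ν : ℝ) : ℝ → ℝ := (Set.Iic ν).indicator (fun x => Real.exp (μ * x - μ ^ 2 / 2))

lemma ftr_meas (μ ν : ℝ) : Measurable (ftr μ ν) :=
  Measurable.indicator (by fun_prop) measurableSet_Iic

lemma ftr_nonneg (μ ν x : ℝ) : 0 ≤ ftr μ ν x :=
  Set.indicator_nonneg (fun _ _ => (Real.exp_pos _).le) x

lemma ftr_int (μ ν : ℝ) : ∫ x, ftr μ ν x ∂(gaussianReal 0 1) = (gaussianReal μ 1).real (Set.Iic ν) := by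
  rw [integral_eq_lintegral_of_nonneg_ae (ae_of_all _ fun x => ftr_nonneg μ ν x)
    (ftr_meas μ ν).aestronglyMeasurable, Measure.real, gauss_density μ, withDensity_apply _ measurableSet_Iic,
    ← lintegral_indicator measurableSet_Iic]
  congr 2
  funext x
  unfold ftr
  by_cases hx : x ∈ Set.Iic ν <;> simp [Set.indicator, hx]

lemma tail_bd (μ a : ℝ) (ha : 0 ≤ a) :
    1 - Real.exp (-a ^ 2 / 2) ≤ (gaussianReal μ 1).real (Set.Iic (μ + a)) := by
  have h1 := measure_ge_le_exp_mul_mgf (μ := gaussianReal μ 1) (X := id) (μ + a) ha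
    (integrable_exp_mul_gaussianReal a)
  rw [mgf_id_gaussianReal, ← Real.exp_add] at h1
  have h2 : (-a * (μ + a) + (μ * a + ((1 : ℝ≥0) : ℝ) * a ^ 2 / 2)) = -a ^ 2 / 2 := by
    simp; ring
  rw [h2] at h1
  have h3 : (gaussianReal μ 1).real (Set.Iic (μ + a)) = 1 - (gaussianReal μ 1).real (Set.Ioi (μ + a)) := by
    rw [← Set.compl_Iic, probReal_compl_eq_one_sub measurableSet_Iic]; ring
  have h4 : (gaussianReal μ 1).real (Set.Ioi (μ + a)) ≤ (gaussianReal μ 1).real {ω | μ + a ≤ id ω} :=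
    measureReal_mono (fun x hx => (le_of_lt hx : μ + a ≤ x))
  linarith

lemma ftr_cases (μ ν x : ℝ) (hμ : 0 ≤ μ) : ftr μ ν x = 0 ∨
    (ftr μ ν x = Real.exp (μ * x - μ ^ 2 / 2) ∧
      Real.exp (μ * x - μ ^ 2 / 2) ≤ Real.exp (μ * ν - μ ^ 2 / 2)) := by
  by_cases hx : x ∈ Set.Iic ν
  · right
    refine ⟨Set.indicator_of_mem hx _, Real.exp_le_exp.2 ?_⟩
    have : x ≤ ν := hx
    nlinarith
  · left
    exact Set.indicator_of_notMem hx _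

lemma ftr_le (μ ν x : ℝ) : ftr μ ν x ≤ Real.exp (μ * x - μ ^ 2 / 2) :=
  Set.indicator_le_self' (fun _ _ => (Real.exp_pos _).le) x

lemma ftr_le_F (μ ν x : ℝ) (hμ : 0 ≤ μ) : ftr μ ν x ≤ Real.exp (μ * ν - μ ^ 2 / 2) := by
  rcases ftr_cases μ ν x hμ with h | ⟨h, h'⟩
  · rw [h]; positivity
  · rw [h]; exact h'

lemma bayes_lb (m : ℕ) (hm : 2 ≤ m) (μ ν b q : ℝ) (hμ : 0 ≤ μ)
    (hF : Real.exp (μ * ν - μ ^ 2 / 2) = ((m : ℝ) - 1) * b)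
    (hq : q = (gaussianReal μ 1).real (Set.Iic ν)) :
    ENNReal.ofReal (μ ^ 2 * (q ^ 2 * (2 - 2 * b - q))) ≤
      bayesRisk m (spikePriorOneSided m μ) := by
  unfold _root_.bayesRisk
  refine le_iInf₂ fun est hest => ?_
  have hm' : (2 : ℝ) ≤ m := by exact_mod_cast hm
  have hn : (0 : ℝ) < (m : ℝ) - 1 := by linarith
  set n : ℝ := (m : ℝ) - 1 with hndef
  set F := Real.exp (μ * ν - μ ^ 2 / 2) with hFdef
  set P := gsm m 0 1 with hP
  have hP' : P = Measure.pi (fun _ : Fin m => gaussianReal 0 1) := by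
    simp [hP, gsm]
  have : IsProbabilityMeasure P := by rw [hP']; infer_instance
  let f : Fin m → (Fin m → ℝ) → ℝ := fun i y => Real.exp (μ * y i - μ ^ 2 / 2)
  have hfpos : ∀ i y, 0 < f i y := fun i y => Real.exp_pos _
  have hfm : ∀ i, Measurable (f i) := fun i => by fun_prop
  let X : Fin m → (Fin m → ℝ) → ℝ := fun i y => ftr μ ν (y i)
  have hXm : ∀ i, Measurable (X i) := fun i => (ftr_meas μ ν).comp (measurable_pi_apply i)
  have hXind : iIndepFun X P := by
    rw [hP']; exact iIndepFun_pi fun j => (ftr_meas μ ν).aemeasurable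
  have hXq : ∀ i, ∫ y, X i y ∂P = q := fun i => by
    rw [hq, ← ftr_int, hP']
    exact integral_comp_eval (μ := fun _ : Fin m => gaussianReal 0 1) (i := i)
      (ftr_meas μ ν).aestronglyMeasurable
  have hq0 : 0 ≤ q := by rw [hq]; positivity
  let H : Fin m → (Fin m → ℝ) → ℝ := fun j y =>
    X j y * (2 * (1 / n) * (∑ i ∈ Finset.univ.erase j, X i y) - (1 / n) ^ 2 *
      ((∑ i ∈ Finset.univ.erase j, X i y) * (F + ∑ i ∈ Finset.univ.erase j, X i y)))
  have hH : ∀ j, Integrable (H j) P ∧ q ^ 2 * (2 - 2 * b - q) ≤ ∫ y, H j y ∂P := fun j =>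
    moment_aux P X hXind hXm F q b n (fun i y => ftr_nonneg _ _ _)
      (fun i y => ftr_le_F _ _ _ hμ) hXq hq0 hn j
      (by rw [Finset.card_erase_of_mem (Finset.mem_univ j), Finset.card_univ, Fintype.card_fin,
            Nat.cast_sub (by omega), hndef]; simp) hF
  let θ : Fin m → Fin m → ℝ := fun i j => if j = i then μ else 0
  have hpt : ∀ y, μ ^ 2 * ∑ j, H j y ≤ ∑ i, f i y * ∑ j, (est y j - θ i j) ^ 2 := fun y => by
    have h1 : ∑ i, f i y * ∑ j, (est y j - θ i j) ^ 2 =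
        ∑ j, (f j y * (est y j - μ) ^ 2 + est y j ^ 2 * ∑ i ∈ Finset.univ.erase j, f i y) := by
      simp_rw [Finset.mul_sum]
      rw [Finset.sum_comm]
      refine Finset.sum_congr rfl fun j _ => ?_
      rw [← Finset.add_sum_erase _ _ (Finset.mem_univ j)]
      congr 1
      · simp [θ]
      · refine Finset.sum_congr rfl fun i hi => ?_
        have : j ≠ i := fun h => (Finset.ne_of_mem_erase hi) h.symm
        simp [θ, this]; ring
    rw [h1, Finset.mul_sum]
    refine Finset.sum_le_sum fun j _ => ?_
    exact pointwise_aux (f j y) F _ _ (est y j) μ (1 / n) (X j y) (hfpos j y)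
      (Finset.sum_nonneg fun i _ => ftr_nonneg _ _ _)
      (Finset.sum_le_sum fun i _ => ftr_le _ _ _) (ftr_cases μ ν (y j) hμ)
  have hestm : ∀ i, Measurable fun y => ENNReal.ofReal (∑ j, (est y j - θ i j) ^ 2) := fun i => by
    have : ∀ j, Measurable fun y => est y j := fun j => (measurable_pi_apply j).comp hest
    fun_prop
  have hrisk : ∀ i, risk m 1 est (θ i) =
      ∫⁻ y, ENNReal.ofReal (f i y * ∑ j, (est y j - θ i j) ^ 2) ∂P := fun i => by
    unfold risk
    rw [gsm_density m μ i, lintegral_withDensity_eq_lintegral_mul _ (by fun_prop) (hestm i)]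
    refine lintegral_congr fun y => ?_
    rw [Pi.mul_apply, ← ENNReal.ofReal_mul (hfpos i y).le]
  have htot : ∫⁻ t, risk m 1 est t ∂(spikePriorOneSided m μ) =
      (m : ℝ≥0∞)⁻¹ * ∫⁻ y, ENNReal.ofReal (∑ i, f i y * ∑ j, (est y j - θ i j) ^ 2) ∂P := by
    unfold spikePriorOneSided
    rw [lintegral_smul_measure, lintegral_finsetSum_measure, smul_eq_mul]
    congr 1
    simp_rw [lintegral_dirac]
    have h2 : ∀ y, ENNReal.ofReal (∑ i, f i y * ∑ j, (est y j - θ i j) ^ 2) =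
        ∑ i, ENNReal.ofReal (f i y * ∑ j, (est y j - θ i j) ^ 2) := fun y =>
      ENNReal.ofReal_sum_of_nonneg fun i _ =>
        mul_nonneg (hfpos i y).le (Finset.sum_nonneg fun j _ => sq_nonneg _)
    rw [lintegral_congr h2, lintegral_finsetSum]
    · exact Finset.sum_congr rfl fun i _ => hrisk i
    · intro i _
      have : ∀ j, Measurable fun y => est y j := fun j => (measurable_pi_apply j).comp hest
      fun_prop
  rw [htot]
  have hint : Integrable (fun y => μ ^ 2 * ∑ j, H j y) P :=
    (integrable_finsetSum _ fun j _ => (hH j).1).const_mul _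
  have h3 : ENNReal.ofReal (m * (μ ^ 2 * (q ^ 2 * (2 - 2 * b - q)))) ≤
      ∫⁻ y, ENNReal.ofReal (∑ i, f i y * ∑ j, (est y j - θ i j) ^ 2) ∂P := by
    refine le_trans (ENNReal.ofReal_le_ofReal ?_) ((ofReal_int_le P _ hint).trans
      (lintegral_mono fun y => ENNReal.ofReal_le_ofReal (hpt y)))
    rw [integral_const_mul, integral_finsetSum _ fun j _ => (hH j).1]
    have h4 : (m : ℝ) * (q ^ 2 * (2 - 2 * b - q)) ≤ ∑ j, ∫ y, H j y ∂P := by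
      have := Finset.card_nsmul_le_sum Finset.univ (fun j => ∫ y, H j y ∂P) _ (fun j _ => (hH j).2)
      simpa using this
    nlinarith [mul_le_mul_of_nonneg_left h4 (sq_nonneg μ)]
  have hm0 : (m : ℝ≥0∞) ≠ 0 := by simp; omega
  calc _ = (m : ℝ≥0∞)⁻¹ * ENNReal.ofReal (m * (μ ^ 2 * (q ^ 2 * (2 - 2 * b - q)))) := by
        rw [ENNReal.ofReal_mul (Nat.cast_nonneg m), ENNReal.ofReal_natCast, ← mul_assoc (m : ℝ≥0∞)⁻¹,
          ENNReal.inv_mul_cancel hm0 (ENNReal.natCast_ne_top m), one_mul]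
    _ ≤ _ := by gcongr

theorem statement17 :
    ∃ c : ℕ → ℝ, Tendsto c atTop (𝓝 1) ∧
      ∀ᶠ m : ℕ in atTop,
        ENNReal.ofReal (nuSeq m ^ 2 -
            2 * c m * nuSeq m * Real.sqrt (2 * Real.log (nuSeq m))) ≤
          bayesRisk m (spikePriorOneSided m
            (nuSeq (m - 1) - Real.sqrt (2 * Real.log (nuSeq (m - 1))))) := by
  have hnu : Tendsto nuSeq atTop atTop := by
    unfold nuSeq
    exact Real.tendsto_sqrt_atTop.comp (Tendsto.const_mul_atTop two_pos
      (Real.tendsto_log_atTop.comp tendsto_natCast_atTop_atTop))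
  have hA : Tendsto (fun m => Real.sqrt (2 * Real.log (nuSeq m))) atTop atTop :=
    Real.tendsto_sqrt_atTop.comp (Tendsto.const_mul_atTop two_pos
      (Real.tendsto_log_atTop.comp hnu))
  refine ⟨fun m => 1 + 4 / Real.sqrt (2 * Real.log (nuSeq m)), ?_, ?_⟩
  · simpa using (hA.const_div_atTop 4).const_add 1
  have hev : ∀ᶠ m : ℕ in atTop, 4 ≤ nuSeq (m - 1) :=
    (hnu.comp (tendsto_sub_atTop_nat 1)).eventually_ge_atTop 4
  filter_upwards [hev, hA.eventually_gt_atTop 0, eventually_ge_atTop 2] with m h4 hA0 hm2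
  set ν := nuSeq (m - 1) with hν
  set N := nuSeq m with hN
  set A := Real.sqrt (2 * Real.log N) with hAdef
  set a := Real.sqrt (2 * Real.log ν) with hadef
  have hm' : (2 : ℝ) ≤ m := by exact_mod_cast hm2
  have hcast : ((m - 1 : ℕ) : ℝ) = (m : ℝ) - 1 := by
    rw [Nat.cast_sub (by omega)]; simp
  have hn1 : (1 : ℝ) ≤ (m : ℝ) - 1 := by linarith
  have hν2 : ν ^ 2 = 2 * Real.log ((m : ℝ) - 1) := by
    rw [hν, nuSeq, hcast, Real.sq_sqrt]
    have := Real.log_nonneg hn1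
    positivity
  have hN2 : N ^ 2 = 2 * Real.log m := by
    rw [hN, nuSeq, Real.sq_sqrt]
    have := Real.log_nonneg (show (1 : ℝ) ≤ m by linarith)
    positivity
  have hν0 : 0 < ν := by linarith
  have hlogν : 0 ≤ Real.log ν := Real.log_nonneg (by linarith)
  have ha2 : a ^ 2 = 2 * Real.log ν := Real.sq_sqrt (by positivity)
  have ha0 : 0 ≤ a := Real.sqrt_nonneg _
  have haν : a ≤ ν := by
    have := Real.log_le_sub_one_of_pos hν0
    refine abs_le_of_sq_le_sq' ?_ hν0.le |>.2
    nlinarith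
  have hNν : ν ≤ N := by
    rw [hν, hN, nuSeq, nuSeq, hcast]
    gcongr
    linarith
  have hN2le : N ^ 2 ≤ ν ^ 2 + 2 := by
    rw [hN2, hν2]
    have h1 : Real.log m ≤ Real.log (2 * ((m : ℝ) - 1)) :=
      Real.log_le_log (by linarith) (by linarith)
    rw [Real.log_mul (by norm_num) (by linarith)] at h1
    have := Real.log_two_lt_d9
    linarith
  have hAa : a ≤ A := by
    rw [hadef, hAdef]; gcongr
  have hexpn : Real.exp (ν ^ 2 / 2) = (m : ℝ) - 1 := by
    rw [hν2, mul_div_cancel_left₀ _ two_ne_zero, Real.exp_log (by linarith)]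
  have hexpa : Real.exp (-a ^ 2 / 2) = ν⁻¹ := by
    rw [ha2, ← Real.exp_log hν0, ← Real.exp_neg, Real.log_exp]
    congr 1; ring
  have hF : Real.exp ((ν - a) * ν - (ν - a) ^ 2 / 2) = ((m : ℝ) - 1) * ν⁻¹ := by
    rw [← hexpn, ← hexpa, ← Real.exp_add]
    congr 1; ring
  set q := (gaussianReal (ν - a) 1).real (Set.Iic ν) with hqdef
  have hq1 : q ≤ 1 := measureReal_le_one
  have hqlb : 1 - ν⁻¹ ≤ q := by
    have := tail_bd (ν - a) a ha0
    rwa [hexpa, sub_add_cancel] at this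
  refine le_trans (ENNReal.ofReal_le_ofReal ?_)
    (bayes_lb m hm2 (ν - a) ν ν⁻¹ q (by linarith) hF hqdef)
  have hb0 : 0 < ν⁻¹ := by positivity
  have hb1 : ν⁻¹ ≤ 1 / 4 := by
    rw [inv_le_comm₀ hν0 (by norm_num)]; norm_num; exact h4
  have hK : 1 - 4 * ν⁻¹ ≤ q ^ 2 * (2 - 2 * ν⁻¹ - q) := by
    have h1 : (1 - ν⁻¹) ^ 2 ≤ q ^ 2 := by
      apply pow_le_pow_left₀ (by linarith) hqlb
    have h2 : 1 - 2 * ν⁻¹ ≤ 2 - 2 * ν⁻¹ - q := by linarith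
    have h3 := mul_le_mul h1 h2 (by linarith) (sq_nonneg q)
    refine le_trans ?_ h3
    nlinarith [mul_nonneg hb0.le hb0.le]
  have h5 : (ν - a) ^ 2 * (1 - 4 * ν⁻¹) ≤ (ν - a) ^ 2 * (q ^ 2 * (2 - 2 * ν⁻¹ - q)) := by gcongr
  refine le_trans ?_ h5
  have h6 : (ν - a) ^ 2 * ν⁻¹ ≤ ν := by
    have : (ν - a) ^ 2 ≤ ν ^ 2 := by nlinarith
    calc (ν - a) ^ 2 * ν⁻¹ ≤ ν ^ 2 * ν⁻¹ := by gcongr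
      _ = ν := by field_simp
  have h7 : 2 * (1 + 4 / A) * N * A = 2 * N * A + 8 * N := by
    field_simp
    ring
  rw [h7]
  have h8 : ν * a ≤ N * A := by
    have : 0 ≤ N := by linarith
    gcongr
  nlinarith
end
end
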